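/- Let (X₀, X₁)_X and (Y₀, Y₁)_Y be pairs of compatible metric spaces with (Y, d_Y) complete, let θ ∈ (0, 1) and q ∈ [1, ∞], and let T: X → Y be a closed operator such that T(X₀) ⊆ Y₀ with T|_{X₀}: (X₀, d₀) → (Y₀, d_{Y₀}) Lipschitz with constant ω₀ > 0, and T(X₁) ⊆ Y₁ with T|_{X₁}: (X₁, d₁) → (Y₁, d_{Y₁}) Lipschitz with constant ω₁ > 0. Then for all x, y ∈ X₀ ∩ X₁, δ_{θ,q;Y}(T(x), T(y)) ≤ 2^{θ}·ω₀^{1-θ}·ω₁^{θ}·δ_{θ,q;X}(x, y); that is, T restricted to the J_M′-interpolated space is Lipschitz with Lipschitz constant not exceeding 2^{θ}·ω₀^{1-θ}·ω₁^{θ}. -/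

import Mathlib

open scoped ENNReal Classical

/-- A function `d` is a metric on the subset `A` of `X`. -/
structure IsMetricOn {X : Type*} (d : X → X → ℝ) (A : Set X) : Prop where
  refl : ∀ x ∈ A, d x x = 0
  eq_of_dist_eq_zero : ∀ x ∈ A, ∀ y ∈ A, d x y = 0 → x = y
  symm : ∀ x ∈ A, ∀ y ∈ A, d x y = d y x
  triangle : ∀ x ∈ A, ∀ y ∈ A, ∀ z ∈ A, d x z ≤ d x y + d y z

/-- A pair of compatible metric spaces `(X₀, X₁)_X` inside an ambient metric space `X`. -/
structure CompatiblePair (X : Type*) [MetricSpace X] where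
  X0 : Set X
  X1 : Set X
  d0 : X → X → ℝ
  d1 : X → X → ℝ
  inter_nonempty : (X0 ∩ X1).Nonempty
  met0 : IsMetricOn d0 X0
  met1 : IsMetricOn d1 X1
  C0 : ℝ
  C1 : ℝ
  C0_pos : 0 < C0
  C1_pos : 0 < C1
  compat0 : ∀ x ∈ X0, ∀ y ∈ X0, dist x y ≤ C0 * d0 x y
  compat1 : ∀ x ∈ X1, ∀ y ∈ X1, dist x y ≤ C1 * d1 x y

namespace CompatiblePair

variable {X : Type*} [MetricSpace X] (P : CompatiblePair X)

/-- The `J_M` functional: `J_M(t; x, y) = max {d₀(x,y), t·d₁(x,y)}`. -/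
noncomputable def JM (t : ℝ) (x y : X) : ℝ := max (P.d0 x y) (t * P.d1 x y)

/-- The cost function `h_t` on pairs in `X₀² ∪ X₁²`. -/
noncomputable def hFun (t : ℝ) (x y : X) : ℝ :=
  if x ∈ P.X0 ∩ P.X1 ∧ y ∈ P.X0 ∩ P.X1 then min (P.d0 x y) (t * P.d1 x y)
  else if x ∈ P.X0 ∧ y ∈ P.X0 then P.d0 x y
  else t * P.d1 x y

/-- `f 0 = x, …, f n = y` is an admissible linking sequence from `x` to `y` in `X₀ ∪ X₁`. -/
def IsAdmissibleChain (x y : X) (n : ℕ) (f : ℕ → X) : Prop :=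
  f 0 = x ∧ f n = y ∧ (∀ k ≤ n, f k ∈ P.X0 ∪ P.X1) ∧
    ∀ k < n, (f k ∈ P.X0 ∧ f (k + 1) ∈ P.X0) ∨ (f k ∈ P.X1 ∧ f (k + 1) ∈ P.X1)

/-- The `K_M` functional: infimum of `∑ h_t` over admissible linking sequences. -/
noncomputable def KM (t : ℝ) (x y : X) : ℝ :=
  sInf { s : ℝ | ∃ n f, P.IsAdmissibleChain x y n f ∧
    s = ∑ k ∈ Finset.range n, P.hFun t (f k) (f (k + 1)) }

end CompatiblePair

/-- The functional `Γ_{θ,q}` of a bi-infinite real sequence, valued in `[0,∞]`. -/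
noncomputable def GammaE (θ : ℝ) (q : ℝ≥0∞) (x : ℤ → ℝ) : ℝ≥0∞ :=
  if q = ∞ then ⨆ k : ℤ, ENNReal.ofReal ((2 : ℝ) ^ (-(k : ℝ) * θ) * |x k|)
  else (∑' k : ℤ, ENNReal.ofReal ((2 : ℝ) ^ (-(k : ℝ) * θ) * |x k|) ^ q.toReal) ^ (1 / q.toReal)

/-- The real-valued functional `Γ_{θ,q}`. -/
noncomputable def Gamma (θ : ℝ) (q : ℝ≥0∞) (x : ℤ → ℝ) : ℝ := (GammaE θ q x).toReal

/-- The constant `M_{θ,q} = Γ_{θ,q}((min{1, 2^k})_k)`. -/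
noncomputable def MThetaQ (θ : ℝ) (q : ℝ≥0∞) : ℝ :=
  Gamma θ q (fun k : ℤ => min 1 ((2 : ℝ) ^ k))

/-- The constant `M'_{θ,q} = (∑_j (2^{jθ} min{1,2^{-j}})^p)^{1/p}` (with `p` the
conjugate exponent of `q`, and the supremum modification for `p = ∞`). -/
noncomputable def MConst' (θ : ℝ) (p : ℝ≥0∞) : ℝ :=
  (if p = ∞ then ⨆ j : ℤ, ENNReal.ofReal ((2 : ℝ) ^ ((j : ℝ) * θ) * min 1 ((2 : ℝ) ^ (-(j : ℝ))))
   else (∑' j : ℤ,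
      ENNReal.ofReal ((2 : ℝ) ^ ((j : ℝ) * θ) * min 1 ((2 : ℝ) ^ (-(j : ℝ)))) ^ p.toReal) ^
        (1 / p.toReal)).toReal

/-- The `ℓ^q` norm of a bi-infinite real sequence, valued in `[0,∞]`. -/
noncomputable def lqNorm (q : ℝ≥0∞) (c : ℤ → ℝ) : ℝ≥0∞ :=
  if q = ∞ then ⨆ k : ℤ, ENNReal.ofReal |c k|
  else (∑' k : ℤ, ENNReal.ofReal |c k| ^ q.toReal) ^ (1 / q.toReal)

namespace CompatiblePair

variable {X : Type*} [MetricSpace X] (P : CompatiblePair X)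

/-- The metric `β_{θ,q}(x,y) = Γ_{θ,q}((K_M(2^k; x, y))_k)` on `X₀ ∩ X₁`. -/
noncomputable def beta (θ : ℝ) (q : ℝ≥0∞) (x y : X) : ℝ :=
  Gamma θ q (fun k : ℤ => P.KM ((2 : ℝ) ^ k) x y)

/-- `u` is an approximating sequence of `x` in `(X₀ ∩ X₁, J_M(1))`: a sequence in
`X₀ ∩ X₁`, Cauchy for `J_M(1)`, with `K_M(1; uₙ, x) → 0`. -/
def IsApproxSeq (x : X) (u : ℕ → X) : Prop :=
  (∀ n, u n ∈ P.X0 ∩ P.X1) ∧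
  (∀ ε > 0, ∃ N, ∀ m ≥ N, ∀ n ≥ N, P.JM 1 (u m) (u n) < ε) ∧
  Filter.Tendsto (fun n => P.KM 1 (u n) x) Filter.atTop (nhds 0)

/-- The bi-infinite linking sequence `S_k = u_k` for `k ≥ 0`, `S_k = v_{-k}` for `k < 0`. -/
noncomputable def linkSeq (u v : ℕ → X) : ℤ → X :=
  fun k => if 0 ≤ k then u k.toNat else v (-k).toNat

/-- The functional `p_{θ,q}` valued in `[0,∞]`: infimum of
`Γ_{θ,q}((J_M(2^k; S_k, S_{k+1}))_k)` over approximating sequences of `x` and `y`. -/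
noncomputable def pFunE (θ : ℝ) (q : ℝ≥0∞) (x y : X) : ℝ≥0∞ :=
  ⨅ (u : ℕ → X) (v : ℕ → X) (_ : P.IsApproxSeq x u) (_ : P.IsApproxSeq y v),
    GammaE θ q (fun k : ℤ =>
      P.JM ((2 : ℝ) ^ k) (linkSeq u v k) (linkSeq u v (k + 1)))

/-- The real-valued functional `p_{θ,q}`. -/
noncomputable def pFun (θ : ℝ) (q : ℝ≥0∞) (x y : X) : ℝ := (P.pFunE θ q x y).toReal

/-- The symmetrization `P_{θ,q}(x,y) = (p_{θ,q}(x,y) + p_{θ,q}(y,x))/2`. -/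
noncomputable def PFun (θ : ℝ) (q : ℝ≥0∞) (x y : X) : ℝ :=
  (P.pFun θ q x y + P.pFun θ q y x) / 2

/-- The metric `δ_{θ,q}`: infimum of `∑ P_{θ,q}` over finite chains in `X₀ ∩ X₁`. -/
noncomputable def delta (θ : ℝ) (q : ℝ≥0∞) (x y : X) : ℝ :=
  sInf { s : ℝ | ∃ (n : ℕ) (f : ℕ → X), f 0 = x ∧ f n = y ∧
    (∀ k ≤ n, f k ∈ P.X0 ∩ P.X1) ∧
    s = ∑ j ∈ Finset.range n, P.PFun θ q (f j) (f (j + 1)) }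

end CompatiblePair

theorem IsMetricOn.nonneg {X : Type*} {d : X → X → ℝ} {A : Set X} (h : IsMetricOn d A)
    {x y : X} (hx : x ∈ A) (hy : y ∈ A) : 0 ≤ d x y := by
  have h₁ := h.triangle x hx y hy x hx
  rw [h.refl x hx, h.symm y hy x hx] at h₁
  linarith

/-- Shifting and scaling: a sequence dominated by `c` times the `j`-shift of `b` has
`Γ_{θ,q}` at most `c * 2 ^ (j * θ)` times that of `b`. -/
theorem GammaE_le_of_shift {θ : ℝ} {q : ℝ≥0∞} (hq : 1 ≤ q) {a b : ℤ → ℝ} {c : ℝ} (hc : 0 ≤ c)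
    (j : ℤ) (h : ∀ k, |a k| ≤ c * |b (k + j)|) :
    GammaE θ q a ≤ ENNReal.ofReal (c * (2 : ℝ) ^ ((j : ℝ) * θ)) * GammaE θ q b := by
  have term (k : ℤ) : ENNReal.ofReal ((2 : ℝ) ^ (-(k : ℝ) * θ) * |a k|) ≤
      ENNReal.ofReal (c * (2 : ℝ) ^ ((j : ℝ) * θ)) *
        ENNReal.ofReal ((2 : ℝ) ^ (-((k + j : ℤ) : ℝ) * θ) * |b (k + j)|) := by
    rw [← ENNReal.ofReal_mul (by positivity)]
    apply ENNReal.ofReal_le_ofReal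
    have e : (2 : ℝ) ^ (-(k : ℝ) * θ) =
        (2 : ℝ) ^ ((j : ℝ) * θ) * (2 : ℝ) ^ (-((k + j : ℤ) : ℝ) * θ) := by
      rw [← Real.rpow_add two_pos]
      push_cast
      ring_nf
    calc (2 : ℝ) ^ (-(k : ℝ) * θ) * |a k|
        ≤ (2 : ℝ) ^ (-(k : ℝ) * θ) * (c * |b (k + j)|) := by gcongr; exact h k
      _ = _ := by rw [e]; ring
  unfold GammaE
  split_ifs with hqt
  · refine iSup_le fun k => (term k).trans ?_
    gcongr
    exact le_iSup (fun k : ℤ => ENNReal.ofReal ((2 : ℝ) ^ (-(k : ℝ) * θ) * |b k|)) (k + j)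
  · have hq0 : 0 < q.toReal :=
      ENNReal.toReal_pos (zero_lt_one.trans_le hq).ne' hqt
    set C := ENNReal.ofReal (c * (2 : ℝ) ^ ((j : ℝ) * θ))
    set B : ℤ → ℝ≥0∞ := fun k => ENNReal.ofReal ((2 : ℝ) ^ (-(k : ℝ) * θ) * |b k|) ^ q.toReal
    calc (∑' k : ℤ, ENNReal.ofReal ((2 : ℝ) ^ (-(k : ℝ) * θ) * |a k|) ^ q.toReal) ^ (1 / q.toReal)
        ≤ (∑' k : ℤ, C ^ q.toReal * B (k + j)) ^ (1 / q.toReal) := by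
          gcongr with k
          rw [← ENNReal.mul_rpow_of_nonneg _ _ hq0.le]
          exact ENNReal.rpow_le_rpow (term k) hq0.le
      _ = C * (∑' k : ℤ, B k) ^ (1 / q.toReal) := by
          rw [ENNReal.tsum_mul_left, show ∑' k, B (k + j) = ∑' k, B k from (Equiv.addRight j).tsum_eq B,
            ENNReal.mul_rpow_of_nonneg _ _ (by positivity), ← ENNReal.rpow_mul,
            mul_one_div_cancel hq0.ne', ENNReal.rpow_one]

theorem GammaE_single_ne_top {θ : ℝ} {q : ℝ≥0∞} (hq : 1 ≤ q) {a : ℤ → ℝ} {m : ℤ}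
    (h : ∀ k, k ≠ m → a k = 0) : GammaE θ q a ≠ ∞ := by
  unfold GammaE
  split_ifs with hqt
  · refine ne_top_of_le_ne_top
      (ENNReal.ofReal_ne_top (r := (2 : ℝ) ^ (-(m : ℝ) * θ) * |a m|)) (iSup_le fun k => ?_)
    by_cases hk : k = m
    · rw [hk]
    · simp [h k hk]
  · have hq0 : 0 < q.toReal :=
      ENNReal.toReal_pos (zero_lt_one.trans_le hq).ne' hqt
    rw [tsum_eq_single m fun k hk => by simp [h k hk, hq0]]
    exact ENNReal.rpow_ne_top_of_nonneg (by positivity)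
      (ENNReal.rpow_ne_top_of_nonneg hq0.le ENNReal.ofReal_ne_top)

namespace CompatiblePair

theorem linkSeq_natCast_neg {X : Type*} (S : ℤ → X) :
    linkSeq (fun n : ℕ => S n) (fun n : ℕ => S (-n)) = S := by
  funext k
  unfold linkSeq
  split_ifs with hk
  · dsimp only
    rw [Int.toNat_of_nonneg hk]
  · dsimp only
    rw [Int.toNat_of_nonneg (by omega), neg_neg]

theorem linkSeq_mem {X : Type*} {A : Set X} {u v : ℕ → X} (hu : ∀ n, u n ∈ A) (hv : ∀ n, v n ∈ A) (k : ℤ) :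
    linkSeq u v k ∈ A := by
  unfold linkSeq
  split_ifs
  exacts [hu _, hv _]

variable {X Y : Type*} [MetricSpace X] [MetricSpace Y]

variable (P : CompatiblePair X)

theorem JM_nonneg (t : ℝ) {x y : X} (hx : x ∈ P.X0) (hy : y ∈ P.X0) : 0 ≤ P.JM t x y :=
  (P.met0.nonneg hx hy).trans (le_max_left _ _)

theorem JM_self (t : ℝ) {x : X} (hx : x ∈ P.X0 ∩ P.X1) : P.JM t x x = 0 := by
  simp [JM, P.met0.refl x hx.1, P.met1.refl x hx.2]

theorem hFun_nonneg {t : ℝ} (ht : 0 ≤ t) {x y : X}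
    (h : (x ∈ P.X0 ∧ y ∈ P.X0) ∨ (x ∈ P.X1 ∧ y ∈ P.X1)) : 0 ≤ P.hFun t x y := by
  unfold hFun
  split_ifs with h₁ h₂
  · exact le_min (P.met0.nonneg h₁.1.1 h₁.2.1) (mul_nonneg ht (P.met1.nonneg h₁.1.2 h₁.2.2))
  · exact P.met0.nonneg h₂.1 h₂.2
  · have h₃ := h.resolve_left h₂
    exact mul_nonneg ht (P.met1.nonneg h₃.1 h₃.2)

theorem hFun_le_d0 {t : ℝ} {x y : X} (hx : x ∈ P.X0) (hy : y ∈ P.X0) :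
    P.hFun t x y ≤ P.d0 x y := by
  unfold hFun
  split_ifs with h₁ h₂
  · exact min_le_left _ _
  · exact le_rfl
  · exact absurd ⟨hx, hy⟩ h₂

theorem hFun_le_d1 {t : ℝ} {x y : X} (hx : x ∈ P.X1) (hy : y ∈ P.X1) :
    P.hFun t x y ≤ t * P.d1 x y := by
  unfold hFun
  split_ifs with h₁ h₂
  · exact min_le_right _ _
  · exact absurd ⟨⟨h₂.1, hx⟩, h₂.2, hy⟩ h₁
  · exact le_rfl

theorem sum_hFun_nonneg {t : ℝ} (ht : 0 ≤ t) {x y : X} {n : ℕ} {f : ℕ → X}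
    (hf : P.IsAdmissibleChain x y n f) :
    0 ≤ ∑ k ∈ Finset.range n, P.hFun t (f k) (f (k + 1)) :=
  Finset.sum_nonneg fun k hk => P.hFun_nonneg ht (hf.2.2.2 k (Finset.mem_range.1 hk))

theorem bddBelow_KM {t : ℝ} (ht : 0 ≤ t) (x y : X) :
    BddBelow { s : ℝ | ∃ n f, P.IsAdmissibleChain x y n f ∧
      s = ∑ k ∈ Finset.range n, P.hFun t (f k) (f (k + 1)) } :=
  ⟨0, by rintro s ⟨n, f, hf, rfl⟩; exact P.sum_hFun_nonneg ht hf⟩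

theorem KM_nonneg {t : ℝ} (ht : 0 ≤ t) (x y : X) : 0 ≤ P.KM t x y :=
  Real.sInf_nonneg (by rintro s ⟨n, f, hf, rfl⟩; exact P.sum_hFun_nonneg ht hf)

theorem KM_self {t : ℝ} (ht : 0 ≤ t) {x : X} (hx : x ∈ P.X0) : P.KM t x x = 0 :=
  le_antisymm (csInf_le (P.bddBelow_KM ht x x)
    ⟨0, fun _ => x, ⟨rfl, rfl, fun _ _ => Or.inl hx, fun _ _ => Or.inl ⟨hx, hx⟩⟩, by simp⟩)
    (P.KM_nonneg ht x x)

theorem isApproxSeq_const {x : X} (hx : x ∈ P.X0 ∩ P.X1) : P.IsApproxSeq x fun _ => x := by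
  refine ⟨fun _ => hx, fun ε hε => ⟨0, fun _ _ _ _ => ?_⟩, ?_⟩
  · rwa [P.JM_self 1 hx]
  · simp [P.KM_self zero_le_one hx.1]

theorem pFunE_ne_top (θ : ℝ) {q : ℝ≥0∞} (hq : 1 ≤ q) {x y : X}
    (hx : x ∈ P.X0 ∩ P.X1) (hy : y ∈ P.X0 ∩ P.X1) : P.pFunE θ q x y ≠ ∞ := by
  refine ne_top_of_le_ne_top (GammaE_single_ne_top hq (m := -1) fun k hk => ?_)
    (iInf_le_of_le (fun _ => x) (iInf_le_of_le (fun _ => y)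
      (iInf_le_of_le (P.isApproxSeq_const hx) (iInf_le_of_le (P.isApproxSeq_const hy) le_rfl))))
  unfold linkSeq
  rcases lt_or_ge k 0 with h | h
  · rw [if_neg (by omega), if_neg (by omega), P.JM_self _ hy]
  · rw [if_pos h, if_pos (by omega), P.JM_self _ hx]

theorem PFun_nonneg (θ : ℝ) (q : ℝ≥0∞) (x y : X) : 0 ≤ P.PFun θ q x y := by
  have h₁ : 0 ≤ P.pFun θ q x y := ENNReal.toReal_nonneg
  have h₂ : 0 ≤ P.pFun θ q y x := ENNReal.toReal_nonneg
  unfold PFun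
  linarith

/-- `T` maps `X₀` to `Y₀` with Lipschitz constant `ω₀` and `X₁` to `Y₁` with Lipschitz
constant `ω₁`. -/
structure LipschitzMap (PX : CompatiblePair X) (PY : CompatiblePair Y) (T : X → Y)
    (ω₀ ω₁ : ℝ) : Prop where
  pos0 : 0 < ω₀
  pos1 : 0 < ω₁
  map0 : ∀ x ∈ PX.X0, T x ∈ PY.X0
  lip0 : ∀ x ∈ PX.X0, ∀ y ∈ PX.X0, PY.d0 (T x) (T y) ≤ ω₀ * PX.d0 x y
  map1 : ∀ x ∈ PX.X1, T x ∈ PY.X1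
  lip1 : ∀ x ∈ PX.X1, ∀ y ∈ PX.X1, PY.d1 (T x) (T y) ≤ ω₁ * PX.d1 x y

namespace LipschitzMap

variable {PX : CompatiblePair X} {PY : CompatiblePair Y} {T : X → Y} {ω₀ ω₁ : ℝ}

theorem map_inter (hT : LipschitzMap PX PY T ω₀ ω₁) {x : X} (hx : x ∈ PX.X0 ∩ PX.X1) :
    T x ∈ PY.X0 ∩ PY.X1 :=
  ⟨hT.map0 x hx.1, hT.map1 x hx.2⟩

theorem hFun_le (hT : LipschitzMap PX PY T ω₀ ω₁) {t : ℝ} (ht : 0 ≤ t) {x y : X}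
    (h : (x ∈ PX.X0 ∧ y ∈ PX.X0) ∨ (x ∈ PX.X1 ∧ y ∈ PX.X1)) :
    PY.hFun t (T x) (T y) ≤ max ω₀ ω₁ * PX.hFun t x y := by
  have H0 : x ∈ PX.X0 → y ∈ PX.X0 → PY.hFun t (T x) (T y) ≤ max ω₀ ω₁ * PX.d0 x y :=
    fun hx hy => (PY.hFun_le_d0 (hT.map0 x hx) (hT.map0 y hy)).trans <|
      (hT.lip0 x hx y hy).trans <|
        mul_le_mul_of_nonneg_right (le_max_left _ _) (PX.met0.nonneg hx hy)
  have H1 : x ∈ PX.X1 → y ∈ PX.X1 → PY.hFun t (T x) (T y) ≤ max ω₀ ω₁ * (t * PX.d1 x y) := by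
    intro hx hy
    calc PY.hFun t (T x) (T y)
        ≤ t * PY.d1 (T x) (T y) := PY.hFun_le_d1 (hT.map1 x hx) (hT.map1 y hy)
      _ ≤ t * (max ω₀ ω₁ * PX.d1 x y) := by
          gcongr
          exact (hT.lip1 x hx y hy).trans <|
            mul_le_mul_of_nonneg_right (le_max_right _ _) (PX.met1.nonneg hx hy)
      _ = _ := by ring
  rw [hFun.eq_def PX]
  split_ifs with h₁ h₂
  · rcases min_choice (PX.d0 x y) (t * PX.d1 x y) with h' | h' <;> rw [h']
    exacts [H0 h₁.1.1 h₁.2.1, H1 h₁.1.2 h₁.2.2]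
  · exact H0 h₂.1 h₂.2
  · have h₃ := h.resolve_left h₂
    exact H1 h₃.1 h₃.2

theorem KM_le (hT : LipschitzMap PX PY T ω₀ ω₁) {t : ℝ} (ht : 0 ≤ t) {x y : X}
    (hx : x ∈ PX.X0) (hy : y ∈ PX.X0) :
    PY.KM t (T x) (T y) ≤ max ω₀ ω₁ * PX.KM t x y := by
  have hM : 0 < max ω₀ ω₁ := lt_max_of_lt_left hT.pos0
  rw [← div_le_iff₀' hM]
  refine le_csInf ⟨_, 1, fun k => if k = 0 then x else y, ⟨rfl, rfl, fun k _ => ?_, fun k _ => ?_⟩,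
    rfl⟩ ?_
  · left; dsimp only; split_ifs <;> assumption
  · left; dsimp only; constructor <;> split_ifs <;> assumption
  · rintro s ⟨n, f, hf, rfl⟩
    rw [div_le_iff₀' hM, Finset.mul_sum]
    refine (csInf_le (PY.bddBelow_KM ht _ _) ⟨n, fun k => T (f k), ⟨?_, ?_, ?_, ?_⟩, rfl⟩).trans
      (Finset.sum_le_sum fun k hk => hT.hFun_le ht (hf.2.2.2 k (Finset.mem_range.1 hk)))
    · exact congrArg T hf.1
    · exact congrArg T hf.2.1
    · exact fun k hk => (hf.2.2.1 k hk).imp (hT.map0 _) (hT.map1 _)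
    · exact fun k hk => (hf.2.2.2 k hk).imp
        (fun h => ⟨hT.map0 _ h.1, hT.map0 _ h.2⟩) (fun h => ⟨hT.map1 _ h.1, hT.map1 _ h.2⟩)

theorem JM_le (hT : LipschitzMap PX PY T ω₀ ω₁) {s t : ℝ} (hs : 0 ≤ s) (hst : ω₁ * s ≤ ω₀ * t)
    {x y : X} (hx : x ∈ PX.X0 ∩ PX.X1) (hy : y ∈ PX.X0 ∩ PX.X1) :
    PY.JM s (T x) (T y) ≤ ω₀ * PX.JM t x y := by
  have h0 := hT.pos0.le
  refine max_le ((hT.lip0 x hx.1 y hy.1).trans ?_) ?_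
  · gcongr
    exact le_max_left _ _
  · calc s * PY.d1 (T x) (T y)
        ≤ s * (ω₁ * PX.d1 x y) := by gcongr; exact hT.lip1 x hx.2 y hy.2
      _ = ω₁ * s * PX.d1 x y := by ring
      _ ≤ ω₀ * t * PX.d1 x y :=
          mul_le_mul_of_nonneg_right hst (PX.met1.nonneg hx.2 hy.2)
      _ = ω₀ * (t * PX.d1 x y) := by ring
      _ ≤ ω₀ * PX.JM t x y := by gcongr; exact le_max_right _ _

/-- A sequence in `Y₀ ∩ Y₁` which eventually agrees with the image under `T` of a
reindexed approximating sequence of `x` is an approximating sequence of `T x`. -/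
theorem isApproxSeq (hT : LipschitzMap PX PY T ω₀ ω₁) {x : X} (hx : x ∈ PX.X0 ∩ PX.X1)
    {u : ℕ → X} (hu : PX.IsApproxSeq x u) {w : ℕ → Y} (hw : ∀ n, w n ∈ PY.X0 ∩ PY.X1)
    {φ : ℕ → ℕ} (hφ : Filter.Tendsto φ Filter.atTop Filter.atTop)
    (hwu : ∀ᶠ n in Filter.atTop, w n = T (u (φ n))) : PY.IsApproxSeq (T x) w := by
  have hM : 0 < max ω₀ ω₁ := lt_max_of_lt_left hT.pos0
  refine ⟨hw, fun ε hε => ?_, ?_⟩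
  · obtain ⟨N, hN⟩ := hu.2.1 (ε / max ω₀ ω₁) (by positivity)
    obtain ⟨N', hN'⟩ :=
      Filter.eventually_atTop.1 (hwu.and (hφ.eventually (Filter.eventually_ge_atTop N)))
    refine ⟨N', fun m hm n hn => ?_⟩
    rw [(hN' m hm).1, (hN' n hn).1]
    have hlt := hN _ (hN' m hm).2 _ (hN' n hn).2
    rw [lt_div_iff₀' hM] at hlt
    refine lt_of_le_of_lt ?_ hlt
    have ha := hu.1 (φ m)
    have hb := hu.1 (φ n)
    refine max_le ((hT.lip0 _ ha.1 _ hb.1).trans ?_) ?_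
    · exact mul_le_mul (le_max_left _ _) (le_max_left _ _) (PX.met0.nonneg ha.1 hb.1) hM.le
    · rw [one_mul]
      refine (hT.lip1 _ ha.2 _ hb.2).trans (mul_le_mul (le_max_right _ _) ?_
        (PX.met1.nonneg ha.2 hb.2) hM.le)
      exact (one_mul (PX.d1 _ _)).symm.le.trans (le_max_right _ _)
  · have hlim : Filter.Tendsto (fun n => max ω₀ ω₁ * PX.KM 1 (u (φ n)) x) Filter.atTop
        (nhds 0) := by
      simpa using (hu.2.2.comp hφ).const_mul (max ω₀ ω₁)
    refine squeeze_zero' (Filter.Eventually.of_forall fun n => PY.KM_nonneg zero_le_one _ _) ?_ hlim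
    filter_upwards [hwu] with n hn
    rw [hn]
    exact hT.KM_le zero_le_one (hu.1 _).1 hx.1

theorem pFunE_le_of_le_zpow (hT : LipschitzMap PX PY T ω₀ ω₁) {θ : ℝ} {q : ℝ≥0∞} (hq : 1 ≤ q)
    {j : ℤ} (hj : ω₁ ≤ ω₀ * (2 : ℝ) ^ j) {x y : X}
    (hx : x ∈ PX.X0 ∩ PX.X1) (hy : y ∈ PX.X0 ∩ PX.X1) :
    PY.pFunE θ q (T x) (T y) ≤
      ENNReal.ofReal (ω₀ * (2 : ℝ) ^ ((j : ℝ) * θ)) * PX.pFunE θ q x y := by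
  have h0 := hT.pos0
  have hpos : 0 < ω₀ * (2 : ℝ) ^ ((j : ℝ) * θ) := by positivity
  have hne : ENNReal.ofReal (ω₀ * (2 : ℝ) ^ ((j : ℝ) * θ)) ≠ 0 := (ENNReal.ofReal_pos.2 hpos).ne'
  unfold pFunE
  simp only [ENNReal.mul_iInf_of_ne hne ENNReal.ofReal_ne_top]
  refine le_iInf fun u => le_iInf fun v => le_iInf fun hu => le_iInf fun hv => ?_
  set S : ℤ → Y := fun k => T (linkSeq u v (k + j)) with hS
  have hmem := linkSeq_mem hu.1 hv.1
  have hSmem (k : ℤ) : S k ∈ PY.X0 ∩ PY.X1 := hT.map_inter (hmem _)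
  have hu' : PY.IsApproxSeq (T x) fun n : ℕ => S n := by
    refine hT.isApproxSeq hx hu (fun n => hSmem n) (φ := fun n => ((n : ℤ) + j).toNat)
      (Filter.tendsto_atTop.2 fun b => ?_) ?_
    · filter_upwards [Filter.eventually_ge_atTop (b + j.natAbs)] with n hn
      omega
    · filter_upwards [Filter.eventually_ge_atTop j.natAbs] with n hn
      simp only [hS, linkSeq]
      rw [if_pos (by omega)]
  have hv' : PY.IsApproxSeq (T y) fun n : ℕ => S (-n) := by
    refine hT.isApproxSeq hy hv (fun n => hSmem _) (φ := fun n => (-(-(n : ℤ) + j)).toNat)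
      (Filter.tendsto_atTop.2 fun b => ?_) ?_
    · filter_upwards [Filter.eventually_ge_atTop (b + j.natAbs)] with n hn
      omega
    · filter_upwards [Filter.eventually_gt_atTop j.natAbs] with n hn
      simp only [hS, linkSeq]
      rw [if_neg (by omega)]
  refine iInf_le_of_le _ (iInf_le_of_le _ (iInf_le_of_le hu' (iInf_le_of_le hv' ?_)))
  rw [linkSeq_natCast_neg S]
  refine GammaE_le_of_shift hq h0.le j fun k => ?_
  rw [abs_of_nonneg (PY.JM_nonneg _ (hSmem _).1 (hSmem _).1),
    abs_of_nonneg (PX.JM_nonneg _ (hmem _).1 (hmem _).1)]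
  simp only [hS]
  rw [add_right_comm k 1 j]
  refine hT.JM_le (by positivity) ?_ (hmem _) (hmem _)
  rw [zpow_add₀ two_ne_zero]
  calc ω₁ * (2 : ℝ) ^ k ≤ ω₀ * (2 : ℝ) ^ j * (2 : ℝ) ^ k := by gcongr
    _ = _ := by ring

theorem pFun_le (hT : LipschitzMap PX PY T ω₀ ω₁) {θ : ℝ} (hθ : 0 ≤ θ) {q : ℝ≥0∞} (hq : 1 ≤ q)
    {x y : X} (hx : x ∈ PX.X0 ∩ PX.X1) (hy : y ∈ PX.X0 ∩ PX.X1) :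
    PY.pFun θ q (T x) (T y) ≤ (2 : ℝ) ^ θ * ω₀ ^ (1 - θ) * ω₁ ^ θ * PX.pFun θ q x y := by
  have h0 := hT.pos0
  have h1 := hT.pos1
  obtain ⟨n, hn, hn'⟩ := exists_mem_Ioc_zpow (div_pos h1 h0) one_lt_two
  have hle := hT.pFunE_le_of_le_zpow (θ := θ) hq ((div_le_iff₀' h0).1 hn') hx hy
  have hreal := ENNReal.toReal_mono
    (ENNReal.mul_ne_top ENNReal.ofReal_ne_top (PX.pFunE_ne_top θ hq hx hy)) hle
  rw [ENNReal.toReal_mul, ENNReal.toReal_ofReal (by positivity)] at hreal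
  refine hreal.trans (mul_le_mul_of_nonneg_right ?_ ENNReal.toReal_nonneg)
  calc ω₀ * (2 : ℝ) ^ (((n + 1 : ℤ) : ℝ) * θ)
      = ω₀ * (2 * (2 : ℝ) ^ n) ^ θ := by
        rw [Real.rpow_mul two_pos.le, Real.rpow_intCast, zpow_add_one₀ two_ne_zero, mul_comm 2]
    _ ≤ ω₀ * (2 * (ω₁ / ω₀)) ^ θ := by gcongr
    _ = (2 : ℝ) ^ θ * ω₀ ^ (1 - θ) * ω₁ ^ θ := by
        rw [Real.mul_rpow two_pos.le (by positivity), Real.div_rpow h1.le h0.le,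
          Real.rpow_sub h0, Real.rpow_one]
        ring

theorem PFun_le (hT : LipschitzMap PX PY T ω₀ ω₁) {θ : ℝ} (hθ : 0 ≤ θ) {q : ℝ≥0∞} (hq : 1 ≤ q)
    {x y : X} (hx : x ∈ PX.X0 ∩ PX.X1) (hy : y ∈ PX.X0 ∩ PX.X1) :
    PY.PFun θ q (T x) (T y) ≤ (2 : ℝ) ^ θ * ω₀ ^ (1 - θ) * ω₁ ^ θ * PX.PFun θ q x y := by
  have h₁ := hT.pFun_le hθ hq hx hy
  have h₂ := hT.pFun_le hθ hq hy hx
  unfold PFun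
  linarith

theorem delta_le (hT : LipschitzMap PX PY T ω₀ ω₁) {θ : ℝ} (hθ : 0 ≤ θ) {q : ℝ≥0∞} (hq : 1 ≤ q)
    {x y : X} (hx : x ∈ PX.X0 ∩ PX.X1) (hy : y ∈ PX.X0 ∩ PX.X1) :
    PY.delta θ q (T x) (T y) ≤ (2 : ℝ) ^ θ * ω₀ ^ (1 - θ) * ω₁ ^ θ * PX.delta θ q x y := by
  have h0 := hT.pos0
  have h1 := hT.pos1
  have hC : 0 < (2 : ℝ) ^ θ * ω₀ ^ (1 - θ) * ω₁ ^ θ := by positivity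
  rw [← div_le_iff₀' hC]
  refine le_csInf ⟨_, 1, fun k => if k = 0 then x else y, rfl, rfl, fun k _ => ?_, rfl⟩ ?_
  · dsimp only
    split_ifs <;> assumption
  · rintro s ⟨n, f, hfx, hfy, hf, rfl⟩
    rw [div_le_iff₀' hC, Finset.mul_sum]
    have hbdd : BddBelow { s : ℝ | ∃ (n : ℕ) (f : ℕ → Y), f 0 = T x ∧ f n = T y ∧
        (∀ k ≤ n, f k ∈ PY.X0 ∩ PY.X1) ∧
        s = ∑ j ∈ Finset.range n, PY.PFun θ q (f j) (f (j + 1)) } := by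
      refine ⟨0, ?_⟩
      rintro s ⟨n, f, -, -, -, rfl⟩
      exact Finset.sum_nonneg fun k _ => PY.PFun_nonneg θ q _ _
    refine (csInf_le hbdd ⟨n, fun k => T (f k), congrArg T hfx, congrArg T hfy,
      fun k hk => hT.map_inter (hf k hk), rfl⟩).trans (Finset.sum_le_sum fun k hk => ?_)
    have hk' := Finset.mem_range.1 hk
    exact hT.PFun_le hθ hq (hf k hk'.le) (hf (k + 1) hk')

end LipschitzMap

end CompatiblePair

/-- interpolation of Lipschitz operators:
`δ_{θ,q;Y}(T x, T y) ≤ 2^θ ω₀^{1-θ} ω₁^θ δ_{θ,q;X}(x, y)` on `X₀ ∩ X₁`. -/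
theorem delta_lipschitz_interpolation {X Y : Type*} [MetricSpace X] [MetricSpace Y]
    [CompleteSpace Y]
    (PX : CompatiblePair X) (PY : CompatiblePair Y)
    (θ : ℝ) (hθ : θ ∈ Set.Ioo (0 : ℝ) 1) (q : ℝ≥0∞) (hq : 1 ≤ q)
    (T : X → Y)
    (hclosed : ∀ (u : ℕ → X) (x : X) (y : Y),
      Filter.Tendsto u Filter.atTop (nhds x) →
      Filter.Tendsto (fun n => T (u n)) Filter.atTop (nhds y) → y = T x)
    (ω₀ ω₁ : ℝ) (hω₀ : 0 < ω₀) (hω₁ : 0 < ω₁)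
    (hT0 : ∀ x ∈ PX.X0, T x ∈ PY.X0)
    (hLip0 : ∀ x ∈ PX.X0, ∀ y ∈ PX.X0, PY.d0 (T x) (T y) ≤ ω₀ * PX.d0 x y)
    (hT1 : ∀ x ∈ PX.X1, T x ∈ PY.X1)
    (hLip1 : ∀ x ∈ PX.X1, ∀ y ∈ PX.X1, PY.d1 (T x) (T y) ≤ ω₁ * PX.d1 x y) :
    ∀ x ∈ PX.X0 ∩ PX.X1, ∀ y ∈ PX.X0 ∩ PX.X1,
      PY.delta θ q (T x) (T y) ≤
        (2 : ℝ) ^ θ * ω₀ ^ (1 - θ) * ω₁ ^ θ * PX.delta θ q x y := by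
  intro x hx y hy
  have hT : CompatiblePair.LipschitzMap PX PY T ω₀ ω₁ := ⟨hω₀, hω₁, hT0, hLip0, hT1, hLip1⟩
  exact hT.delta_le hθ.1.le hq hx hy
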